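/- arXiv:math/0608212 — 2 statements merged into one kernel-verified Lean document; each statement's English description precedes it below -/
import Mathlib

section
/- Let 1 → N → E → Q → 1 be an exact sequence of groups with E finitely generated. Then the pair (E, N) satisfies property (*) — i.e., there exists a set-theoretic section s : E/N → E of the coset projection whose image is a net in E with respect to the word metric — if and only if N is finite. -/
section Preamble

variable {G : Type*} [Group G]

/-- The word length of `g : G` with respect to the generating set `S`. -/
noncomputable def wordLength (S : Set G) (g : G) : ℕ :=
  sInf {n | ∃ w : List G, (∀ x ∈ w, x ∈ S) ∧ w.length = n ∧ w.prod = g}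

/-- The word metric `d(x, y) = |x⁻¹ y|` on the Cayley graph of `G`. -/
noncomputable def wordDist (S : Set G) (x y : G) : ℕ := wordLength S (x⁻¹ * y)

/-- `S` is a finite generating set of `G` closed under inversion. -/
def IsGenSet (S : Set G) : Prop :=
  S.Finite ∧ (∀ x ∈ S, x⁻¹ ∈ S) ∧ Subgroup.closure S = ⊤

/-- `γ`, restricted to `{0, …, n}`, is a geodesic segment in the Cayley graph. -/
def IsGeodesicSegment (S : Set G) (γ : ℕ → G) (n : ℕ) : Prop :=
  ∀ i j, i ≤ n → j ≤ n → wordDist S (γ i) (γ j) = Nat.dist i j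

/-- `r : ℕ → G` is a geodesic ray in the Cayley graph. -/
def IsGeodesicRay (S : Set G) (r : ℕ → G) : Prop :=
  ∀ i j, wordDist S (r i) (r j) = Nat.dist i j

/-- Every geodesic triangle in the Cayley graph of `G` is `δ`-thin: each side lies in
the `δ`-neighborhood of the union of the other two sides. -/
def IsDeltaHyperbolic (S : Set G) (δ : ℕ) : Prop :=
  ∀ (γ₁ γ₂ γ₃ : ℕ → G) (n₁ n₂ n₃ : ℕ),
    IsGeodesicSegment S γ₁ n₁ → IsGeodesicSegment S γ₂ n₂ → IsGeodesicSegment S γ₃ n₃ →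
    γ₁ 0 = γ₃ 0 → γ₁ n₁ = γ₂ 0 → γ₂ n₂ = γ₃ n₃ →
    ∀ k ≤ n₃, ∃ i, (i ≤ n₁ ∧ wordDist S (γ₃ k) (γ₁ i) ≤ δ) ∨
      (i ≤ n₂ ∧ wordDist S (γ₃ k) (γ₂ i) ≤ δ)

/-- `G` is hyperbolic with respect to `S`: some `δ` makes all triangles `δ`-thin. -/
def IsHyperbolic (S : Set G) : Prop := ∃ δ : ℕ, IsDeltaHyperbolic S δ

/-- `H` is a `K`-quasiconvex subgroup: every geodesic between points of `H`
lies in the `K`-neighborhood of `H`. -/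
def IsQuasiconvex (S : Set G) (H : Subgroup G) (K : ℕ) : Prop :=
  ∀ (γ : ℕ → G) (n : ℕ), IsGeodesicSegment S γ n → γ 0 ∈ H → γ n ∈ H →
    ∀ i ≤ n, ∃ h ∈ H, wordDist S (γ i) h ≤ K

/-- Property (*): there is a set-theoretic section `s : G/H → G` of the coset
projection whose image is a net in `G` for the word metric of `S`. -/
def SatisfiesStar (S : Set G) (H : Subgroup G) : Prop :=
  ∃ s : G ⧸ H → G, (∀ q : G ⧸ H, (QuotientGroup.mk (s q) : G ⧸ H) = q) ∧
    ∃ C : ℕ, ∀ g : G, ∃ q : G ⧸ H, wordDist S g (s q) ≤ C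

/-- A hyperbolic group is elementary if it is finite or has an infinite cyclic
subgroup of finite index. -/
def IsElementary (G : Type*) [Group G] : Prop :=
  Finite G ∨ ∃ H : Subgroup G, IsCyclic H ∧ Infinite H ∧ H.index ≠ 0

end Preamble

theorem ball_finite {G : Type*} [Group G] (S : Set G) (hS : IsGenSet S) (C : ℕ) :
    {g : G | wordLength S g ≤ C}.Finite := by
  obtain ⟨hfin, hinv, hcl⟩ := hS
  have : Finite S := hfin
  refine ((List.finite_length_le S C).image
    (fun l : List S => (l.map Subtype.val).prod)).subset ?_
  intro g hg
  have hne : {n | ∃ w : List G, (∀ x ∈ w, x ∈ S) ∧ w.length = n ∧ w.prod = g}.Nonempty := by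
    have hmem : g ∈ Subgroup.closure S := by rw [hcl]; trivial
    rw [← Subgroup.mem_toSubmonoid, Subgroup.closure_toSubmonoid] at hmem
    obtain ⟨l, hl, hp⟩ := Submonoid.exists_list_of_mem_closure hmem
    refine ⟨l.length, l, fun x hx => ?_, rfl, hp⟩
    rcases hl x hx with h | h
    · exact h
    · simpa using hinv _ h
  obtain ⟨w, hw, hlen, hp⟩ := Nat.sInf_mem hne
  have hg' : wordLength S g ≤ C := hg
  refine ⟨w.attach.map (fun x => ⟨x.1, hw x.1 x.2⟩), ?_, ?_⟩
  · simp only [Set.mem_ofPred_eq, List.length_map, List.length_attach]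
    rw [hlen]
    exact hg'
  · simp [List.map_map, Function.comp_def, hp]

/-- (Lemma 4A) For an exact sequence `1 → N → E → Q → 1` with `E`
finitely generated, the pair `(E, N)` satisfies property (*) iff `N` is finite. -/
theorem statement_11 {E Q : Type*} [Group E] [Group Q] (π : E →* Q)
    (hsurj : Function.Surjective π) (S : Set E) (hGen : IsGenSet S) :
    SatisfiesStar S π.ker ↔ Finite π.ker := by
  constructor
  · rintro ⟨s, hs, C, hC⟩
    have hB := ball_finite S hGen C
    refine ((hB.image (fun b => s (QuotientGroup.mk b) * b⁻¹)).subset ?_ :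
      (π.ker : Set E).Finite)
    intro n hn
    obtain ⟨q, hq⟩ := hC n
    refine ⟨n⁻¹ * s q, hq, ?_⟩
    have hqe : (QuotientGroup.mk (n⁻¹ * s q) : E ⧸ π.ker) = q := by
      conv_rhs => rw [← hs q]
      rw [QuotientGroup.eq, MonoidHom.mem_ker]
      have hn' : π n = 1 := hn
      simp [hn']
    simp only [hqe]
    group
  · intro hfin
    refine ⟨Quotient.out, fun q => Quotient.out_eq q, ?_⟩
    obtain ⟨C, hC⟩ := (Set.finite_range (fun n : π.ker => wordLength S (n : E))).bddAbove
    refine ⟨C, fun g => ⟨QuotientGroup.mk g, ?_⟩⟩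
    have hm : g⁻¹ * Quotient.out (QuotientGroup.mk g : E ⧸ π.ker) ∈ π.ker := by
      rw [← QuotientGroup.eq]
      exact (Quotient.out_eq _).symm
    exact hC ⟨⟨_, hm⟩, rfl⟩
end

section
/- Let X = N ⋊ X' be a semidirect product, finitely generated, with quotient map π : X → X/N = X'. Fix a finite generating set Σ of X containing (1, σ') for every σ' ∈ π(Σ), let d be the word metric on X with respect to Σ, and let d' be the word metric on X' with respect to Σ' = π(Σ). Then (X, X') satisfies property (*) if and only if there exist a function φ : X → N and a constant C > 0 such that: (i) whenever φ(α) = φ(α') for α ≠ α' in X, one has d'(πα, πα') ≤ C; and (ii) d(α, (φ(α), π(α))) ≤ C for all α ∈ X, where (φ(α), π(α)) denotes the corresponding element of N ⋊ X'. -/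
theorem wl_le {G : Type*} [Group G] {S : Set G} (w : List G) (h : ∀ x ∈ w, x ∈ S) :
    wordLength S w.prod ≤ w.length :=
  Nat.sInf_le ⟨w, h, rfl, rfl⟩

theorem wl_exists {G : Type*} [Group G] {S : Set G} (hi : ∀ x ∈ S, x⁻¹ ∈ S)
    (hc : Subgroup.closure S = ⊤) (g : G) :
    ∃ w : List G, (∀ x ∈ w, x ∈ S) ∧ w.length = wordLength S g ∧ w.prod = g := by
  have hne : {n | ∃ w : List G, (∀ x ∈ w, x ∈ S) ∧ w.length = n ∧ w.prod = g}.Nonempty := by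
    have hg : g ∈ Subgroup.closure S := by rw [hc]; trivial
    have key : ∃ w : List G, (∀ x ∈ w, x ∈ S) ∧ w.prod = g := by
      induction hg using Subgroup.closure_induction with
      | mem x hx => exact ⟨[x], by simpa using hx, by simp⟩
      | one => exact ⟨[], by simp, by simp⟩
      | mul x y _ _ h1 h2 =>
        obtain ⟨u, hu, rfl⟩ := h1
        obtain ⟨v, hv, rfl⟩ := h2
        refine ⟨u ++ v, fun x hx => ?_, by simp⟩
        rcases List.mem_append.1 hx with h | h
        · exact hu x h
        · exact hv x h
      | inv x _ h1 =>
        obtain ⟨u, hu, rfl⟩ := h1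
        refine ⟨(u.map (·⁻¹)).reverse, fun x hx => ?_, (List.prod_inv_reverse u).symm⟩
        simp only [List.mem_reverse, List.mem_map] at hx
        obtain ⟨y, hy, rfl⟩ := hx
        exact hi y (hu y hy)
    obtain ⟨w, hw, hp⟩ := key
    exact ⟨w.length, w, hw, rfl, hp⟩
  exact Nat.sInf_mem hne

theorem wl_mul {G : Type*} [Group G] {S : Set G} (hi : ∀ x ∈ S, x⁻¹ ∈ S)
    (hc : Subgroup.closure S = ⊤) (g h : G) :
    wordLength S (g * h) ≤ wordLength S g + wordLength S h := by
  obtain ⟨u, hu, hul, hup⟩ := wl_exists hi hc g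
  obtain ⟨v, hv, hvl, hvp⟩ := wl_exists hi hc h
  have := wl_le (S := S) (u ++ v) (by
    intro x hx
    rcases List.mem_append.1 hx with h | h
    · exact hu x h
    · exact hv x h)
  rw [List.prod_append, hup, hvp, List.length_append, hul, hvl] at this
  exact this

theorem wl_inv {G : Type*} [Group G] {S : Set G} (hi : ∀ x ∈ S, x⁻¹ ∈ S)
    (hc : Subgroup.closure S = ⊤) (g : G) :
    wordLength S g⁻¹ ≤ wordLength S g := by
  obtain ⟨u, hu, hul, hup⟩ := wl_exists hi hc g
  have := wl_le (S := S) (u.map (·⁻¹)).reverse (by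
    intro x hx
    simp only [List.mem_reverse, List.mem_map] at hx
    obtain ⟨y, hy, rfl⟩ := hx
    exact hi y (hu y hy))
  rw [← List.prod_inv_reverse, hup, List.length_reverse, List.length_map, hul] at this
  exact this

theorem wl_map {G H : Type*} [Group G] [Group H] {S : Set G} {T : Set H}
    (hi : ∀ x ∈ S, x⁻¹ ∈ S) (hc : Subgroup.closure S = ⊤) (p : G →* H)
    (hp : ∀ x ∈ S, p x ∈ T) (g : G) :
    wordLength T (p g) ≤ wordLength S g := by
  obtain ⟨u, hu, hul, hup⟩ := wl_exists hi hc g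
  have := wl_le (S := T) (u.map p) (by
    intro x hx
    obtain ⟨y, hy, rfl⟩ := List.mem_map.1 hx
    exact hp y (hu y hy))
  rw [← map_list_prod, hup, List.length_map, hul] at this
  exact this

theorem wd_triangle {G : Type*} [Group G] {S : Set G} (hi : ∀ x ∈ S, x⁻¹ ∈ S)
    (hc : Subgroup.closure S = ⊤) (x y z : G) :
    wordDist S x z ≤ wordDist S x y + wordDist S y z := by
  have := wl_mul hi hc (x⁻¹ * y) (y⁻¹ * z)
  have e : x⁻¹ * y * (y⁻¹ * z) = x⁻¹ * z := by group
  rw [e] at this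
  exact this

theorem wd_symm {G : Type*} [Group G] {S : Set G} (hi : ∀ x ∈ S, x⁻¹ ∈ S)
    (hc : Subgroup.closure S = ⊤) (x y : G) :
    wordDist S x y ≤ wordDist S y x := by
  have := wl_inv hi hc (y⁻¹ * x)
  have e : (y⁻¹ * x)⁻¹ = x⁻¹ * y := by group
  rw [e] at this
  exact this

theorem wd_map {G H : Type*} [Group G] [Group H] {S : Set G} {T : Set H}
    (hi : ∀ x ∈ S, x⁻¹ ∈ S) (hc : Subgroup.closure S = ⊤) (p : G →* H)
    (hp : ∀ x ∈ S, p x ∈ T) (x y : G) :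
    wordDist T (p x) (p y) ≤ wordDist S x y := by
  have := wl_map hi hc p hp (x⁻¹ * y)
  rw [map_mul, map_inv] at this
  exact this

/-- (Lemma 4B) For a finitely generated semidirect product
`X = N ⋊ X'`, the pair `(X, X')` satisfies property (*) iff there is a function
`φ : X → N` and a constant `C` with: (i) `φ α = φ α'` for `α ≠ α'` implies
`d'(π α, π α') ≤ C`; (ii) `d(α, (φ α, π α)) ≤ C` for all `α`. -/
theorem statement_12 {N X' : Type*} [Group N] [Group X'] (φ : X' →* MulAut N)
    (S : Set (N ⋊[φ] X')) (hGen : IsGenSet S)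
    (hS : ∀ x ∈ S, SemidirectProduct.inr (SemidirectProduct.rightHom x) ∈ S) :
    SatisfiesStar S (SemidirectProduct.inr : X' →* N ⋊[φ] X').range ↔
      ∃ (f : N ⋊[φ] X' → N) (C : ℕ), 0 < C ∧
        (∀ α α' : N ⋊[φ] X', α ≠ α' → f α = f α' →
          wordDist (SemidirectProduct.rightHom '' S)
            (SemidirectProduct.rightHom α) (SemidirectProduct.rightHom α') ≤ C) ∧
        (∀ α : N ⋊[φ] X',
          wordDist S α ⟨f α, SemidirectProduct.rightHom α⟩ ≤ C) := by
  classical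
  obtain ⟨-, hi, hc⟩ := hGen
  set T : Set X' := SemidirectProduct.rightHom '' S with hT
  have hi' : ∀ x ∈ T, x⁻¹ ∈ T := by
    rintro _ ⟨x, hx, rfl⟩
    exact ⟨x⁻¹, hi x hx, map_inv _ _⟩
  have hc' : Subgroup.closure T = ⊤ := by
    rw [hT, ← MonoidHom.map_closure, hc, ← MonoidHom.range_eq_map,
      MonoidHom.range_eq_top]
    exact SemidirectProduct.rightHom_surjective
  have hproj : ∀ a b : N ⋊[φ] X', wordDist T a.right b.right ≤ wordDist S a b := fun a b =>
    wd_map (T := T) hi hc SemidirectProduct.rightHom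
      (fun x hx => Set.mem_image_of_mem _ hx) a b
  have hfib : ∀ (n : N) (x y : X'),
      wordDist S (⟨n, x⟩ : N ⋊[φ] X') ⟨n, y⟩ ≤ wordDist T x y := by
    intro n x y
    have h1 := wd_map hi' hc' (SemidirectProduct.inr : X' →* N ⋊[φ] X') (T := S)
      (by rintro _ ⟨z, hz, rfl⟩; exact hS z hz) x y
    have e : (⟨n, x⟩ : N ⋊[φ] X')⁻¹ * ⟨n, y⟩
        = (SemidirectProduct.inr x)⁻¹ * SemidirectProduct.inr y := by
      ext <;> simp
    unfold wordDist at h1 ⊢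
    rw [e]
    exact h1
  have hmk : ∀ a b : N ⋊[φ] X',
      ((a : (N ⋊[φ] X') ⧸ (SemidirectProduct.inr : X' →* N ⋊[φ] X').range) = b) ↔
        a.left = b.left := by
    intro a b
    rw [QuotientGroup.eq, MonoidHom.mem_range]
    constructor
    · rintro ⟨z, hz⟩
      have hb : b = a * SemidirectProduct.inr z := by rw [hz]; group
      rw [hb]; simp
    · intro h
      refine ⟨a.right⁻¹ * b.right, ?_⟩
      ext <;> simp [h]
  constructor
  · rintro ⟨s, hs, C, hC⟩
    choose q hq using hC
    refine ⟨fun α => (s (q α)).left, 2 * C + 1, by omega, ?_, ?_⟩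
    · intro α α' _ h
      have hqq : q α = q α' := by
        rw [← hs (q α), ← hs (q α')]
        exact (hmk _ _).2 h
      have h1 := (hproj _ _).trans (hq α)
      have h2 := (hproj _ _).trans (hq α')
      rw [← hqq] at h2
      have h3 := wd_triangle hi' hc' α.right (s (q α)).right α'.right
      have h4 := wd_symm hi' hc' (s (q α)).right α'.right
      change wordDist T α.right α'.right ≤ _
      omega
    · intro α
      have h1 := (hproj _ _).trans (hq α)
      have h2 := hfib (s (q α)).left (s (q α)).right α.right
      have h3 := wd_triangle hi hc α (s (q α)) ⟨(s (q α)).left, α.right⟩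
      have h4 := wd_symm hi' hc' (s (q α)).right α.right
      have h5 := hq α
      change wordDist S (s (q α)) _ ≤ _ at h2
      change wordDist S α ⟨(s (q α)).left, α.right⟩ ≤ _
      omega
  · rintro ⟨f, C, -, h1, h2⟩
    let σ : N → X' := fun n => if h : ∃ α, f α = n then h.choose.right else 1
    refine ⟨fun q => ⟨q.out.left, σ q.out.left⟩, ?_, 2 * C, ?_⟩
    · intro q
      conv_rhs => rw [← QuotientGroup.out_eq' q]
      exact (hmk _ _).2 rfl
    · intro α
      refine ⟨((⟨f α, 1⟩ : N ⋊[φ] X') : (N ⋊[φ] X') ⧸ _), ?_⟩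
      have ho := (hmk _ _).1 (QuotientGroup.out_eq'
        ((⟨f α, 1⟩ : N ⋊[φ] X') : (N ⋊[φ] X') ⧸ (SemidirectProduct.inr : X' →* N ⋊[φ] X').range))
      simp only at ho
      beta_reduce
      rw [ho]
      have hex : ∃ β, f β = f α := ⟨α, rfl⟩
      have hσ : σ (f α) = hex.choose.right := dif_pos hex
      have h3 : wordDist T α.right (σ (f α)) ≤ C := by
        rw [hσ]
        by_cases hne : α = hex.choose
        · rw [← hne]
          unfold wordDist
          rw [inv_mul_cancel]
          exact (wl_le (S := T) [] (by simp)).trans (by simp)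
        · exact h1 _ _ hne hex.choose_spec.symm
      have h4 := hfib (f α) α.right (σ (f α))
      have h5 : wordDist S α ⟨f α, α.right⟩ ≤ C := h2 α
      have h6 := wd_triangle hi hc α ⟨f α, α.right⟩ ⟨f α, σ (f α)⟩
      omega
end
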